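/- With $b_{\ell_1;\varepsilon}$ the Fourier-Legendre coefficients of the mollified indicator $1_{B;\varepsilon}$ of a spherical cap of radius $r \in (0,\pi)$, there exist strictly positive constants $c_1, c_2$ (independent of $\ell$) such that for all large $\ell$: $\frac{c_1}{\ell} \leq 8\pi \sum_{\ell_1} b_{\ell_1;\varepsilon}^2 \frac{1}{2\ell_1+1} \left(C_{\ell 0 \ell 0}^{\ell_1 0}\right)^2 \leq \frac{c_2}{\ell}$. -/

import Mathlib

open Real Polynomial Filter

/-- `q_{2k+1}(t) = ∑_{i=0}^{k} C(2k+1, i) tⁱ (1-t)^{2k+1-i}`. -/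
noncomputable def qFun (k : ℕ) (t : ℝ) : ℝ :=
  ∑ i ∈ Finset.range (k + 1), (Nat.choose (2 * k + 1) i : ℝ) * t ^ i * (1 - t) ^ (2 * k + 1 - i)

/-- The mollified indicator of the cap of radius `r`, in the polar angle. -/
noncomputable def phiMoll (k : ℕ) (r ε θ : ℝ) : ℝ :=
  if θ < r - ε then 1
  else if θ ≤ r then qFun k ((θ - r + ε) / ε)
  else 0

/-- The Legendre polynomial `P_ℓ`, via Rodrigues' formula. -/
noncomputable def legendreP (ℓ : ℕ) : Polynomial ℝ :=
  ((2 ^ ℓ * Nat.factorial ℓ : ℝ))⁻¹ • (Polynomial.derivative)^[ℓ] ((X ^ 2 - 1) ^ ℓ)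

/-- The Fourier–Legendre coefficients of the mollified indicator of a spherical cap. -/
noncomputable def bcoef (k : ℕ) (r ε : ℝ) (ℓ : ℕ) : ℝ :=
  Real.sqrt ((2 * ℓ + 1) / (4 * π)) *
    ∫ x in (-1:ℝ)..1, phiMoll k r ε (Real.arccos x) * (legendreP ℓ).eval x

/-- Factorial of an integer, set to `0` on negative integers. -/
noncomputable def zfact (n : ℤ) : ℝ := if 0 ≤ n then (Nat.factorial n.toNat : ℝ) else 0

/-- Inverse factorial of an integer, set to `0` on negative integers. -/
noncomputable def zinvfact (n : ℤ) : ℝ := if 0 ≤ n then ((Nat.factorial n.toNat : ℝ))⁻¹ else 0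

/-- The Clebsch–Gordan coefficient `C^{l3 m3}_{l1 m1 l2 m2}`, via Racah's algebraic formula. -/
noncomputable def CG (l1 m1 l2 m2 l3 m3 : ℤ) : ℝ :=
  if m1 + m2 = m3 then
    Real.sqrt (((2 * l3 + 1 : ℤ) : ℝ) * zfact (l3 + l1 - l2) * zfact (l3 - l1 + l2) *
        zfact (l1 + l2 - l3) / zfact (l1 + l2 + l3 + 1)) *
      Real.sqrt (zfact (l3 + m3) * zfact (l3 - m3) * zfact (l1 - m1) * zfact (l1 + m1) *
        zfact (l2 - m2) * zfact (l2 + m2)) *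
      ∑ k ∈ Finset.range (l1 + l2 + l3 + 1).toNat,
        (-1 : ℝ) ^ k * zinvfact (k : ℤ) * zinvfact (l1 + l2 - l3 - k) * zinvfact (l1 - m1 - k) *
          zinvfact (l2 + m2 - k) * zinvfact (l3 - l2 + m1 + k) * zinvfact (l3 - l1 - m2 + k)
  else 0


theorem zinvfact_eq_succ_mul (n : ℤ) : zinvfact n = (n + 1) * zinvfact (n + 1) := by
  unfold zinvfact
  rcases lt_trichotomy n (-1) with h | h | h
  · rw [if_neg (by omega), if_neg (by omega), mul_zero]
  · subst h; simp
  · rw [if_pos (by omega), if_pos (by omega)]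
    lift n to ℕ using by omega
    have : ((n : ℤ) + 1).toNat = n + 1 := by omega
    rw [this, Nat.factorial_succ]
    push_cast
    have : ((n : ℝ) + 1) ≠ 0 := by positivity
    simp only [Int.toNat_natCast]
    field_simp

theorem zinvfact_of_neg {n : ℤ} (h : n < 0) : zinvfact n = 0 := if_neg (by omega)

theorem zfact_natCast (n : ℕ) : zfact n = (n.factorial : ℝ) := by simp [zfact]

theorem zfact_nonneg (n : ℤ) : 0 ≤ zfact n := by
  unfold zfact; split_ifs <;> positivity

/-- The summand in Dixon's identity. -/
noncomputable def dixonTerm (a b j : ℤ) : ℝ :=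
  (-1) ^ j * (zinvfact (a + j) * zinvfact (a - j)) * (zinvfact (b + j) * zinvfact (b - j)) ^ 2

theorem dixonTerm_eq_zero {a b j : ℤ} (h : j ∉ Finset.Icc (-b) b) : dixonTerm a b j = 0 := by
  rw [Finset.mem_Icc, not_and_or] at h
  unfold dixonTerm
  rcases h with h | h
  · rw [zinvfact_of_neg (show b + j < 0 by omega)]; simp
  · rw [zinvfact_of_neg (show b - j < 0 by omega)]; simp

theorem dixonTerm_pred (a b j : ℤ) :
    dixonTerm a b j = ((a + 1) ^ 2 - j ^ 2) * dixonTerm (a + 1) b j := by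
  have h1 := zinvfact_eq_succ_mul (a + j)
  have h2 := zinvfact_eq_succ_mul (a - j)
  rw [show a + j + 1 = a + 1 + j by ring] at h1
  rw [show a - j + 1 = a + 1 - j by ring] at h2
  unfold dixonTerm
  rw [h1, h2]
  push_cast
  ring

theorem dixonTerm_shift (a b j : ℤ) :
    (a + (j + 1)) * (b + (j + 1)) ^ 2 * dixonTerm a b (j + 1) =
      -((a - j) * (b - j) ^ 2 * dixonTerm a b j) := by
  have key : ∀ c : ℤ, (c + (j + 1)) * (zinvfact (c + (j + 1)) * zinvfact (c - (j + 1))) =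
      (c - j) * (zinvfact (c + j) * zinvfact (c - j)) := by
    intro c
    have h1 := zinvfact_eq_succ_mul (c + j)
    have h2 := zinvfact_eq_succ_mul (c - (j + 1))
    rw [show c - (j + 1) + 1 = c - j by ring] at h2
    rw [h2, h1, show c + (j + 1) = c + j + 1 by ring]
    push_cast
    ring
  have ha := key a
  have hb := key b
  unfold dixonTerm
  rw [zpow_add_one₀ (by norm_num)]
  calc _ = -((-1) ^ j * ((a + (j + 1)) * (zinvfact (a + (j + 1)) * zinvfact (a - (j + 1)))) *
        ((b + (j + 1)) * (zinvfact (b + (j + 1)) * zinvfact (b - (j + 1)))) ^ 2) := by ring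
    _ = _ := by rw [ha, hb]; ring

theorem summable_dixonTerm_mul (a b : ℤ) (g : ℤ → ℝ) :
    Summable fun j => g j * dixonTerm a b j :=
  summable_of_ne_finset_zero (s := Finset.Icc (-b) b) fun j hj => by
    rw [dixonTerm_eq_zero hj, mul_zero]

theorem tsum_dixonTerm_succ (a b : ℤ) :
    (a + 1) * (a + b + 1) ^ 2 * ∑' j, dixonTerm (a + 1) b j =
      (a + 2 * b + 1) * ∑' j, dixonTerm a b j := by
  let G : ℤ → ℝ := fun j => (-(a + 1 + j) * (b + j) ^ 2 / 2) * dixonTerm (a + 1) b j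
  have hG : Summable G := summable_dixonTerm_mul _ _ _
  have hG1 : Summable fun j => G (j + 1) := (Equiv.addRight (1 : ℤ)).summable_iff.2 hG
  have hshift : ∑' j, G (j + 1) = ∑' j, G j := (Equiv.addRight (1 : ℤ)).tsum_eq G
  have hsum (a : ℤ) (x : ℝ) : Summable fun j => x * dixonTerm a b j :=
    summable_dixonTerm_mul _ _ _
  have hpt : ∀ j, (a + 1) * (a + b + 1) ^ 2 * dixonTerm (a + 1) b j -
      (a + 2 * b + 1) * dixonTerm a b j = G (j + 1) - G j := by
    intro j
    have h := dixonTerm_shift (a + 1) b j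
    rw [dixonTerm_pred a b j]
    simp only [G]
    push_cast at h ⊢
    linear_combination h / 2
  have := tsum_congr (L := .unconditional ℤ) hpt
  rw [(hsum _ _).tsum_sub (hsum _ _), hG1.tsum_sub hG, hshift, sub_self, tsum_mul_left,
    tsum_mul_left] at this
  linarith

/-- **Dixon's identity**, with two of the three parameters equal. -/
theorem tsum_dixonTerm (a b : ℕ) :
    ∑' j, dixonTerm a b j = ((a + 2 * b).factorial : ℝ) /
      (a.factorial * b.factorial ^ 2 * (a + b).factorial ^ 2 * (2 * b).factorial) := by
  induction a with
  | zero =>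
    rw [tsum_eq_single 0]
    · simp [dixonTerm, zinvfact]
      have := Nat.factorial_ne_zero b
      have := Nat.factorial_ne_zero (2 * b)
      field_simp
    · intro j hj
      unfold dixonTerm
      rcases lt_or_gt_of_ne hj with h | h
      · rw [zinvfact_of_neg (show ((0 : ℕ) : ℤ) + j < 0 by simpa using h)]; simp
      · rw [zinvfact_of_neg (show ((0 : ℕ) : ℤ) - j < 0 by simpa using h)]; simp
  | succ a ih =>
    have h := tsum_dixonTerm_succ a b
    rw [ih] at h
    push_cast at h ⊢
    have h0 : ((a : ℝ) + 1) * (a + b + 1) ^ 2 ≠ 0 := by positivity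
    refine mul_left_cancel₀ h0 (h.trans ?_)
    rw [show a + 1 + 2 * b = (a + 2 * b) + 1 by ring, show a + 1 + b = (a + b) + 1 by ring,
      Nat.factorial_succ, Nat.factorial_succ, Nat.factorial_succ]
    push_cast
    have := Nat.factorial_ne_zero a
    have := Nat.factorial_ne_zero b
    have := Nat.factorial_ne_zero (a + b)
    have := Nat.factorial_ne_zero (2 * b)
    have : (a : ℝ) + b + 1 ≠ 0 := by positivity
    field_simp

/-- The alternating sum in Racah's formula for `C^{L 0}_{ℓ 0 ℓ 0}`. -/
noncomputable def racahTerm (ℓ L k : ℤ) : ℝ :=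
  (-1) ^ k * (zinvfact k * zinvfact (2 * ℓ - L - k)) *
    (zinvfact (ℓ - k) * zinvfact (L - ℓ + k)) ^ 2

theorem CG_sq (ℓ L : ℕ) (h : L ≤ 2 * ℓ) :
    (CG ℓ 0 ℓ 0 L 0) ^ 2 =
      (2 * L + 1) * L.factorial ^ 4 * (2 * ℓ - L).factorial * ℓ.factorial ^ 4 /
        (2 * ℓ + L + 1).factorial * (∑' j, racahTerm ℓ L j) ^ 2 := by
  have hS : ∑ k ∈ Finset.range ((ℓ : ℤ) + ℓ + L + 1).toNat,
        (-1 : ℝ) ^ k * zinvfact (k : ℤ) * zinvfact (ℓ + ℓ - L - k) * zinvfact (ℓ - 0 - k) *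
          zinvfact (ℓ + 0 - k) * zinvfact (L - ℓ + 0 + k) * zinvfact (L - ℓ - 0 + k) =
      ∑' j, racahTerm ℓ L j := by
    rw [tsum_eq_sum (s := (Finset.range ((ℓ : ℤ) + ℓ + L + 1).toNat).map Nat.castEmbedding),
      Finset.sum_map]
    · refine Finset.sum_congr rfl fun k _ => ?_
      simp only [racahTerm, Nat.castEmbedding_apply, zpow_natCast, sub_zero, add_zero, two_mul]
      ring
    · intro j hj
      unfold racahTerm
      rcases lt_or_ge j 0 with h0 | h0
      · rw [zinvfact_of_neg h0]; simp
      · rw [zinvfact_of_neg (show 2 * (ℓ : ℤ) - L - j < 0 from ?_)]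
        · simp
        · by_contra hc
          apply hj
          rw [Finset.mem_map]
          exact ⟨j.toNat, by rw [Finset.mem_range]; omega, by simp [h0]⟩
  unfold CG
  rw [if_pos (by simp), hS, mul_pow, mul_pow, Real.sq_sqrt, Real.sq_sqrt]
  · rw [show (L : ℤ) + ℓ - ℓ = L by ring, show (L : ℤ) - ℓ + ℓ = L by ring,
      show (ℓ : ℤ) + ℓ - L = ((2 * ℓ - L : ℕ) : ℤ) by omega,
      show (ℓ : ℤ) + ℓ + L + 1 = ((2 * ℓ + L + 1 : ℕ) : ℤ) by push_cast; ring]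
    simp only [sub_zero, add_zero, zfact_natCast]
    push_cast
    ring
  · simp only [sub_zero, add_zero]
    have := zfact_nonneg ℓ
    have := zfact_nonneg L
    positivity
  · have h1 := zfact_nonneg ((L : ℤ) + ℓ - ℓ)
    have h2 := zfact_nonneg ((L : ℤ) - ℓ + ℓ)
    have h3 := zfact_nonneg ((ℓ : ℤ) + ℓ - L)
    have h4 := zfact_nonneg ((ℓ : ℤ) + ℓ + L + 1)
    have h5 : (0 : ℝ) ≤ ((2 * (L : ℤ) + 1 : ℤ) : ℝ) := by push_cast; positivity
    positivity

theorem CG_eq_zero_of_lt {ℓ L : ℕ} (h : 2 * ℓ < L) : CG ℓ 0 ℓ 0 L 0 = 0 := by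
  unfold CG
  rw [show zfact ((ℓ : ℤ) + ℓ - L) = 0 from if_neg (by omega)]
  simp

theorem tsum_racahTerm_of_odd (ℓ L : ℕ) (h : Odd L) : ∑' j, racahTerm ℓ L j = 0 := by
  have h1 : ∑' j, racahTerm ℓ L (2 * ℓ - L - j) = ∑' j, racahTerm ℓ L j :=
    (Equiv.subLeft (2 * (ℓ : ℤ) - L)).tsum_eq _
  have h2 : ∀ j, racahTerm ℓ L (2 * ℓ - L - j) = -racahTerm ℓ L j := by
    intro j
    unfold racahTerm
    have hs : (-1 : ℝ) ^ (2 * (ℓ : ℤ) - L - j) = -(-1) ^ j := by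
      rw [zpow_sub₀ (by norm_num), Odd.neg_one_zpow]
      · rcases Int.even_or_odd j with hj | hj <;> simp [hj.neg_one_zpow]
      · obtain ⟨m, rfl⟩ := h
        exact ⟨ℓ - m - 1, by push_cast; ring⟩
    rw [hs, show 2 * (ℓ : ℤ) - L - (2 * ℓ - L - j) = j by ring,
      show (ℓ : ℤ) - (2 * ℓ - L - j) = L - ℓ + j by ring,
      show (L : ℤ) - ℓ + (2 * ℓ - L - j) = ℓ - j by ring]
    ring
  rw [tsum_congr h2, tsum_neg] at h1
  linarith

theorem tsum_racahTerm_sq_even (p q : ℕ) :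
    (∑' j, racahTerm (p + q : ℕ) (2 * p : ℕ) j) ^ 2 =
      (((q + 2 * p).factorial : ℝ) /
        (q.factorial * p.factorial ^ 2 * (q + p).factorial ^ 2 * (2 * p).factorial)) ^ 2 := by
  have h1 : ∑' j, racahTerm (p + q : ℕ) (2 * p : ℕ) (j + q) =
      ∑' j, racahTerm (p + q : ℕ) (2 * p : ℕ) j :=
    (Equiv.addRight (q : ℤ)).tsum_eq _
  have h2 : ∀ j, racahTerm (p + q : ℕ) (2 * p : ℕ) (j + q) = (-1) ^ q * dixonTerm q p j := by
    intro j
    unfold racahTerm dixonTerm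
    rw [zpow_add₀ (by norm_num), zpow_natCast]
    push_cast
    rw [show 2 * ((p : ℤ) + q) - 2 * p - (j + q) = q - j by ring,
      show (p : ℤ) + q - (j + q) = p - j by ring,
      show 2 * (p : ℤ) - (p + q) + (j + q) = p + j by ring, add_comm j (q : ℤ)]
    ring
  rw [← h1, tsum_congr h2, tsum_mul_left, tsum_dixonTerm, mul_pow, ← pow_mul, mul_comm q 2,
    pow_mul, neg_one_sq, one_pow, one_mul]

theorem choose_mul_choose_le (a b i j : ℕ) :
    a.choose i * b.choose j ≤ (a + b).choose (i + j) := by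
  rw [Nat.add_choose_eq]
  exact Finset.single_le_sum (f := fun ij : ℕ × ℕ => a.choose ij.1 * b.choose ij.2)
    (fun _ _ => Nat.zero_le _) (a := (i, j)) (by simp)

theorem CG_sq_even (p q : ℕ) :
    (CG (p + q : ℕ) 0 (p + q : ℕ) 0 (2 * p : ℕ) 0) ^ 2 =
      (4 * p + 1) / (2 * (2 * p + q) + 1) *
        (p.centralBinom ^ 2 * q.centralBinom / (2 * p + q).centralBinom) := by
  have hc (n : ℕ) : (n.centralBinom : ℝ) = (2 * n).factorial / (n.factorial ^ 2) := by
    rw [Nat.centralBinom, Nat.cast_choose ℝ (by omega), show 2 * n - n = n by omega, sq]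
  rw [CG_sq _ _ (by omega), tsum_racahTerm_sq_even, hc, hc, hc,
    show 2 * (p + q) - 2 * p = 2 * q by omega,
    show 2 * (p + q) + 2 * p + 1 = 2 * (2 * p + q) + 1 by ring, add_comm q, add_comm q,
    Nat.factorial_succ (2 * (2 * p + q))]
  have := Nat.factorial_ne_zero p
  have := Nat.factorial_ne_zero q
  have := Nat.factorial_ne_zero (p + q)
  have := Nat.factorial_ne_zero (2 * p)
  have := Nat.factorial_ne_zero (2 * q)
  have := Nat.factorial_ne_zero (2 * p + q)
  have := Nat.factorial_ne_zero (2 * (2 * p + q))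
  have : 2 * (2 * (p : ℝ) + q) + 1 ≠ 0 := by positivity
  push_cast
  field_simp
  ring

theorem CG_sq_le (ℓ L : ℕ) : (CG ℓ 0 ℓ 0 L 0) ^ 2 ≤ (2 * L + 1) / (2 * ℓ + 1) := by
  have hpos : (0 : ℝ) ≤ (2 * L + 1) / (2 * ℓ + 1) := by positivity
  rcases lt_or_ge (2 * ℓ) L with h | h
  · rw [CG_eq_zero_of_lt h]; simpa using hpos
  rcases Nat.even_or_odd' L with ⟨p, rfl | rfl⟩
  · obtain ⟨q, rfl⟩ := Nat.exists_eq_add_of_le (show p ≤ ℓ by omega)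
    rw [CG_sq_even]
    have hle : ((p.centralBinom : ℝ) ^ 2 * q.centralBinom / (2 * p + q).centralBinom) ≤ 1 := by
      refine div_le_one_of_le₀ ?_ (by positivity)
      have h1 := choose_mul_choose_le (2 * p) (2 * p) p p
      have h2 := choose_mul_choose_le (2 * p + 2 * p) (2 * q) (p + p) q
      have h3 : p.centralBinom ^ 2 * q.centralBinom ≤ (2 * p + q).centralBinom := by
        unfold Nat.centralBinom
        rw [show 2 * (2 * p + q) = 2 * p + 2 * p + 2 * q by ring, sq]
        refine le_trans (Nat.mul_le_mul_right _ h1) (h2.trans_eq ?_)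
        rw [two_mul p]
      exact_mod_cast h3
    refine (mul_le_of_le_one_right (by positivity) hle).trans ?_
    push_cast
    rw [← mul_assoc]
    norm_num
    gcongr
    linarith [Nat.cast_nonneg (α := ℝ) p]
  · rw [CG_sq _ _ h, tsum_racahTerm_of_odd _ _ ⟨p, rfl⟩]
    simpa using hpos

theorem CG_zero_sq (ℓ : ℕ) : (CG ℓ 0 ℓ 0 (0 : ℕ) 0) ^ 2 = 1 / (2 * ℓ + 1) := by
  have h := CG_sq_even 0 ℓ
  simp only [mul_zero, zero_add, Nat.centralBinom_zero] at h
  rw [h]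
  have := Nat.centralBinom_ne_zero ℓ
  push_cast
  field_simp
  norm_num

theorem intervalIntegrable_eval (p : ℝ[X]) (a b : ℝ) :
    IntervalIntegrable (fun x => p.eval x) MeasureTheory.volume a b :=
  p.continuous.intervalIntegrable _ _

theorem integral_derivative_mul {a b : ℝ} (p q : ℝ[X]) (ha : p.eval a = 0) (hb : p.eval b = 0) :
    ∫ x in a..b, (derivative p).eval x * q.eval x =
      -∫ x in a..b, p.eval x * (derivative q).eval x := by
  have h : ∫ x in a..b, (derivative (p * q)).eval x = 0 := by
    rw [intervalIntegral.integral_eq_sub_of_hasDerivAt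
      (fun x _ => (p * q).hasDerivAt x) (intervalIntegrable_eval _ _ _)]
    simp [ha, hb]
  simp only [derivative_mul, eval_add, eval_mul] at h
  rw [intervalIntegral.integral_add] at h
  · linarith
  · simpa using intervalIntegrable_eval (derivative p * q) a b
  · simpa using intervalIntegrable_eval (p * derivative q) a b

theorem eval_iterate_derivative_pow_eq_zero {w : ℝ[X]} {x : ℝ} (hx : w.eval x = 0) {k n : ℕ}
    (h : k < n) : (derivative^[k] (w ^ n)).eval x = 0 := by
  obtain ⟨c, hc⟩ := pow_sub_dvd_iterate_derivative_pow w n k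
  rw [hc, eval_mul, eval_pow, hx, zero_pow (by omega), zero_mul]

theorem integral_iterate_derivative_pow_mul {a b : ℝ} {w : ℝ[X]} (ha : w.eval a = 0)
    (hb : w.eval b = 0) {k n : ℕ} (h : k ≤ n) (q : ℝ[X]) :
    ∫ x in a..b, (derivative^[k] (w ^ n)).eval x * q.eval x =
      (-1) ^ k * ∫ x in a..b, (w ^ n).eval x * (derivative^[k] q).eval x := by
  induction k generalizing q with
  | zero => simp
  | succ k ih =>
    rw [Function.iterate_succ_apply', integral_derivative_mul _ _
      (eval_iterate_derivative_pow_eq_zero ha h) (eval_iterate_derivative_pow_eq_zero hb h),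
      ih (by omega), Function.iterate_succ_apply, pow_succ]
    ring

theorem integral_legendreP_mul (n : ℕ) (q : ℝ[X]) :
    ∫ x in (-1 : ℝ)..1, (legendreP n).eval x * q.eval x =
      (2 ^ n * n.factorial : ℝ)⁻¹ *
        ∫ x in (-1 : ℝ)..1, (1 - x ^ 2) ^ n * (derivative^[n] q).eval x := by
  have h := integral_iterate_derivative_pow_mul (a := -1) (b := 1) (w := (X ^ 2 - 1 : ℝ[X]))
    (by simp) (by simp) (le_refl n) q
  simp only [legendreP, eval_smul, smul_eq_mul, mul_assoc]
  rw [intervalIntegral.integral_const_mul, h, ← intervalIntegral.integral_const_mul]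
  congr 2
  ext x
  rw [← mul_assoc, eval_pow, ← mul_pow]
  congr 2
  simp

theorem natDegree_X_sq_sub_one_pow (n : ℕ) : ((X ^ 2 - 1 : ℝ[X]) ^ n).natDegree = 2 * n := by
  have : (X ^ 2 - 1 : ℝ[X]).natDegree = 2 := by compute_degree!
  rw [natDegree_pow, this, mul_comm]

theorem natDegree_legendreP_le (n : ℕ) : (legendreP n).natDegree ≤ n := by
  refine (natDegree_smul_le _ _).trans ((natDegree_iterate_derivative _ _).trans ?_)
  rw [natDegree_X_sq_sub_one_pow]
  omega

theorem integral_legendreP_mul_of_lt {m n : ℕ} (h : m < n) :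
    ∫ x in (-1 : ℝ)..1, (legendreP n).eval x * (legendreP m).eval x = 0 := by
  rw [integral_legendreP_mul,
    iterate_derivative_eq_zero ((natDegree_legendreP_le m).trans_lt h)]
  simp

theorem integral_legendreP_mul_of_ne {m n : ℕ} (h : m ≠ n) :
    ∫ x in (-1 : ℝ)..1, (legendreP n).eval x * (legendreP m).eval x = 0 := by
  rcases lt_or_gt_of_ne h with h | h
  · exact integral_legendreP_mul_of_lt h
  · simpa only [mul_comm] using integral_legendreP_mul_of_lt h

theorem iterate_derivative_legendreP (n : ℕ) :
    derivative^[n] (legendreP n) = C ((2 ^ n * n.factorial : ℝ)⁻¹ * (2 * n).factorial) := by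
  have hm : ((X ^ 2 - 1 : ℝ[X]) ^ n).coeff (2 * n) = 1 := by
    have : ((X ^ 2 - 1 : ℝ[X]) ^ n).Monic :=
      (monic_X_pow_sub_C (1 : ℝ) two_ne_zero).pow n
    rw [← natDegree_X_sq_sub_one_pow n]
    exact this
  rw [legendreP, iterate_derivative_smul, ← Function.iterate_add_apply, ← two_mul, C_mul,
    smul_eq_C_mul]
  congr 1
  ext i
  rw [coeff_iterate_derivative, coeff_C]
  split_ifs with hi
  · subst hi
    rw [zero_add, hm, Nat.descFactorial_self]
    simp
  · rw [coeff_eq_zero_of_natDegree_lt, smul_zero]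
    rw [natDegree_X_sq_sub_one_pow]
    omega

theorem integral_one_sub_sq_pow_succ (n : ℕ) :
    (2 * n + 3 : ℝ) * ∫ x in (-1 : ℝ)..1, (1 - x ^ 2) ^ (n + 1) =
      (2 * n + 2 : ℝ) * ∫ x in (-1 : ℝ)..1, (1 - x ^ 2) ^ n := by
  have hi (m : ℕ) : IntervalIntegrable (fun x : ℝ => (1 - x ^ 2) ^ m) MeasureTheory.volume (-1) 1 :=
    Continuous.intervalIntegrable (by fun_prop) _ _
  have hd : ∀ x : ℝ, HasDerivAt (fun x : ℝ => x * (1 - x ^ 2) ^ (n + 1))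
      ((2 * n + 3) * (1 - x ^ 2) ^ (n + 1) - (2 * n + 2) * (1 - x ^ 2) ^ n) x := by
    intro x
    refine HasDerivAt.congr_deriv
      ((hasDerivAt_id x).mul (((hasDerivAt_pow 2 x).const_sub 1).pow (n + 1))) ?_
    simp
    ring
  have h := intervalIntegral.integral_eq_sub_of_hasDerivAt (a := -1) (b := 1) (fun x _ => hd x)
    (((hi _).const_mul _).sub ((hi _).const_mul _))
  rw [intervalIntegral.integral_sub ((hi _).const_mul _) ((hi _).const_mul _),
    intervalIntegral.integral_const_mul, intervalIntegral.integral_const_mul] at h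
  simp at h
  linarith

theorem integral_one_sub_sq_pow (n : ℕ) :
    ∫ x in (-1 : ℝ)..1, (1 - x ^ 2) ^ n =
      2 * (2 ^ n * n.factorial : ℝ) ^ 2 / (2 * n + 1).factorial := by
  induction n with
  | zero => norm_num
  | succ n ih =>
    have h := integral_one_sub_sq_pow_succ n
    rw [ih] at h
    have h0 : (2 * (n : ℝ) + 3) ≠ 0 := by positivity
    refine mul_left_cancel₀ h0 (h.trans ?_)
    rw [show 2 * (n + 1) + 1 = 2 * n + 1 + 1 + 1 by ring, Nat.factorial_succ (2 * n + 1 + 1),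
      Nat.factorial_succ (2 * n + 1), Nat.factorial_succ n]
    push_cast
    have := Nat.factorial_ne_zero (2 * n + 1)
    have : 2 * (n : ℝ) + 1 + 1 + 1 ≠ 0 := by positivity
    have : 2 * (n : ℝ) + 1 + 1 ≠ 0 := by positivity
    field_simp
    ring

theorem integral_legendreP_mul_self (n : ℕ) :
    ∫ x in (-1 : ℝ)..1, (legendreP n).eval x * (legendreP n).eval x = 2 / (2 * n + 1) := by
  rw [integral_legendreP_mul, iterate_derivative_legendreP]
  simp only [eval_C]
  rw [intervalIntegral.integral_mul_const, integral_one_sub_sq_pow, Nat.factorial_succ]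
  push_cast
  have := Nat.factorial_ne_zero n
  have := Nat.factorial_ne_zero (2 * n)
  field_simp

/-- **Bessel's inequality** for the Legendre polynomials. -/
theorem sum_sq_integral_mul_legendreP_le {f : ℝ → ℝ}
    (hf : IntervalIntegrable f MeasureTheory.volume (-1) 1)
    (hf2 : IntervalIntegrable (fun x => f x ^ 2) MeasureTheory.volume (-1) 1) (s : Finset ℕ) :
    ∑ n ∈ s, (2 * n + 1) / 2 * (∫ x in (-1 : ℝ)..1, f x * (legendreP n).eval x) ^ 2 ≤
      ∫ x in (-1 : ℝ)..1, f x ^ 2 := by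
  set a : ℕ → ℝ := fun n => ∫ x in (-1 : ℝ)..1, f x * (legendreP n).eval x
  let c : ℕ → ℝ := fun n => (2 * n + 1) / 2 * a n
  let Q : ℝ[X] := ∑ n ∈ s, C (c n) * legendreP n
  have hfp (p : ℝ[X]) : IntervalIntegrable (fun x => f x * p.eval x) MeasureTheory.volume (-1) 1 :=
    hf.mul_continuousOn p.continuous.continuousOn
  have hpp (p q : ℝ[X]) :
      IntervalIntegrable (fun x => p.eval x * q.eval x) MeasureTheory.volume (-1) 1 := by
    simpa using intervalIntegrable_eval (p * q) (-1) 1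
  have hfQ : ∫ x in (-1 : ℝ)..1, f x * Q.eval x = ∑ n ∈ s, (2 * n + 1) / 2 * a n ^ 2 := by
    simp only [Q, eval_finsetSum, Finset.mul_sum, eval_mul, eval_C]
    rw [intervalIntegral.integral_finsetSum]
    · refine Finset.sum_congr rfl fun n _ => ?_
      simp only [mul_left_comm (f _)]
      rw [intervalIntegral.integral_const_mul]
      simp only [c, a]
      ring
    · intro n _
      simpa only [mul_left_comm (f _)] using (hfp (legendreP n)).const_mul (c n)
  have hPQ : ∀ n ∈ s, ∫ x in (-1 : ℝ)..1, (legendreP n).eval x * Q.eval x = a n := by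
    intro n hn
    simp only [Q, eval_finsetSum, Finset.mul_sum, eval_mul, eval_C, mul_left_comm (eval _ _)]
    rw [intervalIntegral.integral_finsetSum fun m _ => (hpp _ _).const_mul _]
    simp only [intervalIntegral.integral_const_mul]
    rw [Finset.sum_eq_single_of_mem n hn, integral_legendreP_mul_self]
    · simp only [c]
      field_simp
    · intro m _ hm
      rw [integral_legendreP_mul_of_ne hm, mul_zero]
  have hQQ : ∫ x in (-1 : ℝ)..1, Q.eval x * Q.eval x = ∑ n ∈ s, (2 * n + 1) / 2 * a n ^ 2 := by
    have : ∀ x, Q.eval x * Q.eval x = ∑ n ∈ s, c n * ((legendreP n).eval x * Q.eval x) := by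
      intro x
      nth_rewrite 1 [show Q = ∑ n ∈ s, C (c n) * legendreP n from rfl]
      simp only [eval_finsetSum, Finset.sum_mul, eval_mul, eval_C, mul_assoc]
    simp only [this]
    rw [intervalIntegral.integral_finsetSum fun m _ => (hpp _ _).const_mul _]
    refine Finset.sum_congr rfl fun n hn => ?_
    rw [intervalIntegral.integral_const_mul, hPQ n hn]
    simp only [c]
    ring
  have h0 : 0 ≤ ∫ x in (-1 : ℝ)..1, (f x - Q.eval x) ^ 2 :=
    intervalIntegral.integral_nonneg (by norm_num) fun x _ => sq_nonneg _
  have hexp : ∀ x, (f x - Q.eval x) ^ 2 =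
      f x ^ 2 - 2 * (f x * Q.eval x) + Q.eval x * Q.eval x := fun x => by ring
  simp only [hexp] at h0
  rw [intervalIntegral.integral_add (hf2.sub ((hfp Q).const_mul 2)) (hpp Q Q),
    intervalIntegral.integral_sub hf2 ((hfp Q).const_mul 2),
    intervalIntegral.integral_const_mul, hfQ, hQQ] at h0
  linarith

theorem qFun_nonneg (k : ℕ) {t : ℝ} (h0 : 0 ≤ t) (h1 : t ≤ 1) : 0 ≤ qFun k t := by
  have := sub_nonneg.2 h1
  exact Finset.sum_nonneg fun i _ => by positivity

theorem qFun_le_one (k : ℕ) {t : ℝ} (h0 : 0 ≤ t) (h1 : t ≤ 1) : qFun k t ≤ 1 := by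
  have h1' := sub_nonneg.2 h1
  have h := add_pow t (1 - t) (2 * k + 1)
  rw [add_sub_cancel, one_pow] at h
  rw [h, qFun]
  calc _ = ∑ i ∈ Finset.range (k + 1),
        t ^ i * (1 - t) ^ (2 * k + 1 - i) * ((2 * k + 1).choose i : ℝ) :=
        Finset.sum_congr rfl fun i _ => by ring
    _ ≤ _ := Finset.sum_le_sum_of_subset_of_nonneg
        (Finset.range_mono (by omega)) fun i _ _ => by positivity

theorem measurable_phiMoll (k : ℕ) (r ε : ℝ) : Measurable (phiMoll k r ε) := by
  unfold phiMoll qFun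
  refine Measurable.ite measurableSet_Iio measurable_const
    (Measurable.ite measurableSet_Iic ?_ measurable_const)
  fun_prop

theorem phiMoll_mem_Icc (k : ℕ) (r : ℝ) {ε : ℝ} (hε : 0 < ε) (θ : ℝ) :
    phiMoll k r ε θ ∈ Set.Icc (0 : ℝ) 1 := by
  unfold phiMoll
  split_ifs with h1 h2
  · simp
  · have h0 : 0 ≤ (θ - r + ε) / ε := div_nonneg (by linarith) hε.le
    have h1 : (θ - r + ε) / ε ≤ 1 := by rw [div_le_one hε]; linarith
    exact ⟨qFun_nonneg k h0 h1, qFun_le_one k h0 h1⟩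
  · simp

theorem intervalIntegrable_phiMoll_arccos_pow (k : ℕ) (r : ℝ) {ε : ℝ} (hε : 0 < ε) (n : ℕ)
    (a b : ℝ) :
    IntervalIntegrable (fun x => phiMoll k r ε (arccos x) ^ n) MeasureTheory.volume a b := by
  refine (intervalIntegrable_const (c := (1 : ℝ))).mono_fun
    (((measurable_phiMoll k r ε).comp measurable_arccos).pow_const n).aestronglyMeasurable
    (Eventually.of_forall fun x => ?_)
  obtain ⟨h0, h1⟩ := phiMoll_mem_Icc k r hε (arccos x)
  simpa [abs_of_nonneg h0] using pow_le_one₀ h0 h1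

theorem sum_bcoef_sq_le (k : ℕ) (r : ℝ) {ε : ℝ} (hε : 0 < ε) (s : Finset ℕ) :
    ∑ n ∈ s, bcoef k r ε n ^ 2 ≤ 1 / π := by
  have hint (n : ℕ) := intervalIntegrable_phiMoll_arccos_pow k r hε n (-1) 1
  have h := sum_sq_integral_mul_legendreP_le (by simpa using hint 1) (hint 2) s
  have h2 : ∫ x in (-1 : ℝ)..1, phiMoll k r ε (arccos x) ^ 2 ≤ ∫ x in (-1 : ℝ)..1, (1 : ℝ) :=
    intervalIntegral.integral_mono_on (by norm_num) (hint 2) intervalIntegrable_const fun x _ => by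
      obtain ⟨h0, h1⟩ := phiMoll_mem_Icc k r hε (arccos x)
      exact pow_le_one₀ h0 h1
  have h3 := h.trans h2
  norm_num at h3
  have hb : ∀ n, bcoef k r ε n ^ 2 = 1 / (2 * π) * ((2 * n + 1) / 2 *
      (∫ x in (-1 : ℝ)..1, phiMoll k r ε (arccos x) * (legendreP n).eval x) ^ 2) := by
    intro n
    rw [bcoef, mul_pow, Real.sq_sqrt (by positivity)]
    field_simp
    ring
  simp only [hb]
  rw [← Finset.mul_sum]
  calc _ ≤ 1 / (2 * π) * 2 := by gcongr
    _ = _ := by field_simp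

theorem bcoef_zero_pos (k : ℕ) {r ε : ℝ} (hrπ : r < π) (hε : 0 < ε) (hεr : ε < r) :
    0 < bcoef k r ε 0 := by
  have hP : ∀ x : ℝ, (legendreP 0).eval x = 1 := by simp [legendreP]
  unfold bcoef
  simp only [hP, mul_one]
  refine mul_pos (Real.sqrt_pos.2 (by positivity)) ?_
  have hint (a b : ℝ) := by simpa using intervalIntegrable_phiMoll_arccos_pow k r hε 1 a b
  set d := cos (r - ε)
  have hd1 : d < 1 := by
    rw [← cos_zero]
    exact cos_lt_cos_of_nonneg_of_le_pi le_rfl (by linarith) (by linarith)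
  rw [← intervalIntegral.integral_add_adjacent_intervals (hint (-1) d) (hint d 1)]
  refine add_pos_of_nonneg_of_pos (intervalIntegral.integral_nonneg (neg_one_le_cos _)
    fun x _ => (phiMoll_mem_Icc k r hε _).1) ?_
  refine intervalIntegral.intervalIntegral_pos_of_pos_on (hint d 1) (fun x hx => ?_) hd1
  have hx1 : arccos x < r - ε := by
    rw [← arccos_cos (x := r - ε) (by linarith) (by linarith)]
    exact arccos_lt_arccos (neg_one_le_cos _) hx.1 hx.2.le
  simp [phiMoll, hx1]

theorem second_chaos_variance_two_sided_bound (k : ℕ) (r ε : ℝ)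
    (hr : 0 < r) (hrπ : r < π) (hε : 0 < ε) (hεr : ε < r) :
    ∃ c₁ c₂ : ℝ, 0 < c₁ ∧ 0 < c₂ ∧
      ∀ᶠ ℓ : ℕ in atTop,
        c₁ / ℓ ≤
            8 * π * ∑' ℓ₁ : ℕ,
              bcoef k r ε ℓ₁ ^ 2 * (1 / (2 * ℓ₁ + 1)) * (CG ℓ 0 ℓ 0 ℓ₁ 0) ^ 2 ∧
          8 * π * ∑' ℓ₁ : ℕ,
              bcoef k r ε ℓ₁ ^ 2 * (1 / (2 * ℓ₁ + 1)) * (CG ℓ 0 ℓ 0 ℓ₁ 0) ^ 2 ≤ c₂ / ℓ := by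
  have hsupp : ∀ ℓ n : ℕ, n ∉ Finset.range (2 * ℓ + 1) →
      bcoef k r ε n ^ 2 * (1 / (2 * n + 1)) * (CG ℓ 0 ℓ 0 n 0) ^ 2 = 0 := by
    intro ℓ n hn
    rw [CG_eq_zero_of_lt (by rw [Finset.mem_range] at hn; omega)]
    simp
  have hb := bcoef_zero_pos k hrπ hε hεr
  refine ⟨8 * π * bcoef k r ε 0 ^ 2 / 3, 8, by positivity, by norm_num, ?_⟩
  filter_upwards [eventually_ge_atTop 1] with ℓ hℓ
  have hℓ' : (1 : ℝ) ≤ ℓ := by exact_mod_cast hℓ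
  rw [tsum_eq_sum (hsupp ℓ)]
  constructor
  · have h := Finset.single_le_sum
      (f := fun n : ℕ => bcoef k r ε n ^ 2 * (1 / (2 * n + 1)) * (CG ℓ 0 ℓ 0 n 0) ^ 2)
      (s := Finset.range (2 * ℓ + 1)) (fun n _ => by positivity)
      (Finset.mem_range.2 (Nat.succ_pos _) : 0 ∈ _)
    simp only [CG_zero_sq] at h
    calc 8 * π * bcoef k r ε 0 ^ 2 / 3 / ℓ = 8 * π * (bcoef k r ε 0 ^ 2 * (1 / (3 * ℓ))) := by
          field_simp
      _ ≤ 8 * π * (bcoef k r ε 0 ^ 2 * (1 / (2 * ℓ + 1))) := by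
          gcongr
          linarith
      _ ≤ _ := by
          gcongr
          simpa using h
  · calc _ ≤ 8 * π * ∑ n ∈ Finset.range (2 * ℓ + 1), bcoef k r ε n ^ 2 * (1 / ℓ) := by
          refine mul_le_mul_of_nonneg_left (Finset.sum_le_sum fun n _ => ?_) (by positivity)
          rw [mul_assoc]
          refine mul_le_mul_of_nonneg_left ?_ (sq_nonneg _)
          calc 1 / (2 * (n : ℝ) + 1) * CG ℓ 0 ℓ 0 n 0 ^ 2
              ≤ 1 / (2 * (n : ℝ) + 1) * ((2 * n + 1) / (2 * ℓ + 1)) := by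
                gcongr
                exact CG_sq_le ℓ n
            _ = 1 / (2 * ℓ + 1) := by field_simp
            _ ≤ 1 / ℓ := by
                gcongr
                linarith
      _ ≤ 8 * π * (1 / π * (1 / ℓ)) := by
          rw [← Finset.sum_mul]
          gcongr
          exact sum_bcoef_sq_le k r hε _
      _ = 8 / ℓ := by field_simp
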